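/- The function F(z) = log h(z)/(z²−1)^{1/2} − (1/π) ∫_{−1}^{1} log h(x)/(√(1−x²)(z−x)) dx, defined for z in U∖[−1,1], extends analytically across [−1,1]: there exist an open set V with [−1,1] ⊆ V ⊆ U and an analytic function G on V such that G(z) = F(z) for all z ∈ V∖[−1,1]. In particular F has finite limits c₀ at z = 1 and d₀ at z = −1, and F is given near 1 by a convergent power series Σ_{n≥0} c_n (z−1)^n and near −1 by a convergent power series Σ_{n≥0} d_n (z+1)^n. -/

import Mathlib

open Complex Filter Set MeasureTheory

noncomputable section

/-- The segment [-1,1] regarded as a subset of the complex plane. -/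
def seg : Set ℂ := Complex.ofReal '' Set.Icc (-1) 1

theorem aux_cos_mem (θ : ℝ) : ((Real.cos θ : ℝ) : ℂ) ∈ seg :=
  ⟨Real.cos θ, ⟨Real.neg_one_le_cos θ, Real.cos_le_one θ⟩, rfl⟩

theorem aux_seg_compact : IsCompact seg :=
  isCompact_Icc.image Complex.continuous_ofReal

/-- Differentiation of a bounded holomorphic family under the integral sign. -/
theorem aux_diffInt (f : ℂ → ℝ → ℂ) (z0 : ℂ) (r B : ℝ) (hr : 0 < r)
    (hc : ∀ z ∈ Metric.ball z0 (2 * r), Continuous (f z))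
    (hd : ∀ θ, DifferentiableOn ℂ (fun z => f z θ) (Metric.ball z0 (2 * r)))
    (hB : ∀ θ, ∀ z ∈ Metric.ball z0 (2 * r), ‖f z θ‖ ≤ B) :
    HasDerivAt (fun z => ∫ θ in (0:ℝ)..Real.pi, f z θ)
      (∫ θ in (0:ℝ)..Real.pi, deriv (fun z => f z θ) z0) z0 := by
  have hz0 : z0 ∈ Metric.ball z0 (2 * r) := Metric.mem_ball_self (by positivity)
  have hda : ∀ θ, ∀ z ∈ Metric.ball z0 (2 * r),
      HasDerivAt (fun z => f z θ) (deriv (fun z => f z θ) z) z := fun θ z hz =>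
    ((hd θ).differentiableAt (Metric.isOpen_ball.mem_nhds hz)).hasDerivAt
  refine (intervalIntegral.hasDerivAt_integral_of_dominated_loc_of_deriv_le
    (F := f) (F' := fun z θ => deriv (fun z => f z θ) z) (x₀ := z0)
    (s := Metric.ball z0 (r / 2)) (bound := fun _ => B / r)
    (Metric.ball_mem_nhds z0 (by positivity)) ?_ ?_ ?_ ?_ ?_ ?_).2
  · filter_upwards [Metric.ball_mem_nhds z0 (show 0 < 2 * r by positivity)] with z hz
    exact (hc z hz).aestronglyMeasurable
  · exact (hc z0 hz0).intervalIntegrable _ _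
  · let u : ℕ → ℂ := fun n => z0 + (r : ℂ) * (1 / ((n : ℂ) + 1))
    have hu0 : Tendsto u atTop (nhds z0) := by
      have h1 : Tendsto (fun n : ℕ => 1 / ((n : ℂ) + 1)) atTop (nhds 0) :=
        tendsto_one_div_add_atTop_nhds_zero_nat
      have := (h1.const_mul (r : ℂ)).const_add z0
      simpa [u] using this
    have hune : ∀ n, u n ≠ z0 := by
      intro n hn
      have hn1 : ((n : ℂ) + 1) ≠ 0 := Nat.cast_add_one_ne_zero n
      have : (r : ℂ) ≠ 0 := by exact_mod_cast hr.ne'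
      simp [u, this, hn1] at hn
    have hub : ∀ n, u n ∈ Metric.ball z0 (2 * r) := by
      intro n
      have h1 : ‖((n : ℂ) + 1)‖ = (n : ℝ) + 1 := by
        rw [← Nat.cast_add_one, Complex.norm_natCast]; push_cast; rfl
      have h2 : 1 / ((n : ℝ) + 1) ≤ 1 := by
        rw [div_le_one (by positivity)]; linarith [(Nat.cast_nonneg n : (0:ℝ) ≤ n)]
      rw [mem_ball_iff_norm]
      simp only [u, add_sub_cancel_left, norm_mul, norm_div, norm_one, h1, Complex.norm_real,
        Real.norm_eq_abs, abs_of_pos hr]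
      nlinarith
    have hu1 : Tendsto u atTop (nhdsWithin z0 {z0}ᶜ) :=
      tendsto_nhdsWithin_iff.2 ⟨hu0, Eventually.of_forall hune⟩
    refine aestronglyMeasurable_of_tendsto_ae atTop
      (f := fun n θ => slope (fun z => f z θ) z0 (u n)) ?_ ?_
    · intro n
      have := hc _ (hub n)
      have := hc _ hz0
      apply Continuous.aestronglyMeasurable
      simp only [slope, vsub_eq_sub]
      fun_prop
    · exact Eventually.of_forall fun θ =>
        (hasDerivAt_iff_tendsto_slope.1 (hda θ z0 hz0)).comp hu1
  · refine Eventually.of_forall fun θ _ z hz => ?_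
    have hsub : Metric.closedBall z r ⊆ Metric.ball z0 (2 * r) := by
      intro w hw
      rw [Metric.mem_ball] at *
      rw [Metric.mem_closedBall] at hw
      linarith [dist_triangle w z z0]
    apply Complex.norm_deriv_le_of_forall_mem_sphere_norm_le hr
    · apply DifferentiableOn.diffContOnCl
      rw [closure_ball _ hr.ne']
      exact (hd θ).mono hsub
    · exact fun w hw => hB θ w (hsub (Metric.sphere_subset_closedBall hw))
  · exact intervalIntegrable_const
  · refine Eventually.of_forall fun θ _ z hz => hda θ z ?_
    exact Metric.ball_subset_ball (by linarith) hz

theorem aux_subst (g : ℝ → ℂ) :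
    (∫ x in (-1:ℝ)..1, g x / ((Real.sqrt (1 - x ^ 2) : ℝ) : ℂ)) =
      ∫ θ in (0:ℝ)..Real.pi, g (Real.cos θ) := by
  have key := integral_Icc_deriv_smul_of_deriv_nonpos (f := Real.cos) (f' := fun x => -Real.sin x)
    (a := 0) (b := Real.pi) (g := fun x => g x / ((Real.sqrt (1 - x ^ 2) : ℝ) : ℂ))
    Real.continuous_cos.continuousOn (fun x _ => Real.hasDerivAt_cos x)
    (fun x hx => by linarith [Real.sin_pos_of_mem_Ioo hx]) Real.pi_pos.le
  rw [intervalIntegral.integral_of_le (by norm_num), intervalIntegral.integral_of_le Real.pi_pos.le,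
    ← integral_Icc_eq_integral_Ioc, integral_Ioc_eq_integral_Ioo]
  simp only [Real.cos_pi, Real.cos_zero] at key
  rw [integral_Icc_eq_integral_Ioo (f := fun x => -Real.sin x • (g (Real.cos x) / ((Real.sqrt (1 - (Real.cos x) ^ 2) : ℝ) : ℂ)))] at key
  rw [← neg_eq_iff_eq_neg.2 key, ← integral_neg]
  refine setIntegral_congr_fun measurableSet_Ioo fun x hx => ?_
  have hs := Real.sin_pos_of_mem_Ioo hx
  have h1 : Real.sqrt (1 - Real.cos x ^ 2) = Real.sin x := by
    rw [← Real.sin_sq, Real.sqrt_sq hs.le]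
  have h2 : (Real.sin x : ℂ) ≠ 0 := by exact_mod_cast hs.ne'
  simp only [h1, neg_smul, neg_neg, real_smul]
  field_simp

/-- Joint local bound for the divided difference. -/
theorem aux_bound (U : Set ℂ) (hU : IsOpen U) (hseg : seg ⊆ U) (L : ℂ → ℂ)
    (hL : DifferentiableOn ℂ L U) (z0 : ℂ) (hz0 : z0 ∈ U) :
    ∃ r > 0, ∃ B, Metric.ball z0 (2 * r) ⊆ U ∧
      ∀ x ∈ seg, ∀ z ∈ Metric.ball z0 (2 * r), ‖dslope L x z‖ ≤ B := by
  obtain ⟨ε, hε, hεU⟩ := Metric.isOpen_iff.1 hU z0 hz0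
  have hsub : Metric.closedBall z0 (3 * (ε / 4)) ⊆ U :=
    (Metric.closedBall_subset_ball (by linarith)).trans hεU
  obtain ⟨M, hM⟩ := (isCompact_closedBall z0 (3 * (ε / 4))).exists_bound_of_continuousOn
    (hL.continuousOn.mono hsub)
  obtain ⟨M', hM'⟩ := aux_seg_compact.exists_bound_of_continuousOn (hL.continuousOn.mono hseg)
  obtain ⟨C, hC⟩ := (isCompact_closedBall z0 (3 * (ε / 4))).exists_bound_of_continuousOn
    ((hL.deriv hU).continuousOn.mono hsub)
  have hr : 0 < ε / 4 := by positivity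
  refine ⟨ε / 4, hr, max C ((M + M') / (ε / 4)), ?_, ?_⟩
  · exact (Metric.ball_subset_ball (by linarith)).trans hεU
  intro x hx z hz
  have hz3 : z ∈ Metric.closedBall z0 (3 * (ε / 4)) :=
    Metric.ball_subset_closedBall (Metric.ball_subset_ball (by linarith) hz)
  by_cases hzx : z = x
  · subst hzx
    rw [dslope_same]
    exact (hC _ hz3).trans (le_max_left _ _)
  have hpos : 0 < ‖z - x‖ := norm_pos_iff.2 (sub_ne_zero.2 hzx)
  rw [dslope_of_ne _ hzx, slope_def_field, norm_div]
  by_cases hx3 : x ∈ Metric.closedBall z0 (3 * (ε / 4))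
  · refine le_trans ?_ (le_max_left _ _)
    rw [div_le_iff₀ hpos]
    exact (convex_closedBall z0 (3 * (ε / 4))).norm_image_sub_le_of_norm_deriv_le
      (fun w hw => hL.differentiableAt (hU.mem_nhds (hsub hw))) hC hx3 hz3
  · refine le_trans ?_ (le_max_right _ _)
    have h1 : ε / 4 ≤ ‖z - x‖ := by
      rw [Metric.mem_closedBall, not_le] at hx3
      rw [Metric.mem_ball] at hz
      rw [← dist_eq_norm]
      linarith [dist_triangle x z z0, dist_comm x z]
    apply div_le_div₀ _ _ hr h1
    · linarith [norm_nonneg (L z), norm_nonneg (L x), hM z hz3, hM' x hx]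
    · exact (norm_sub_le _ _).trans (add_le_add (hM z hz3) (hM' x hx))

theorem aux_ne (z : ℂ) (hz : z ∉ seg) (θ : ℝ) : z - (Real.cos θ : ℂ) ≠ 0 := by
  intro h
  exact hz (sub_eq_zero.1 h ▸ aux_cos_mem θ)

theorem aux_cont_inv (z : ℂ) (hz : z ∉ seg) :
    Continuous (fun θ : ℝ => 1 / (z - (Real.cos θ : ℂ))) := by
  refine Continuous.div continuous_const (by fun_prop) (aux_ne z hz)

theorem aux_I_deriv (z0 : ℂ) (hz : z0 ∉ seg) :
    HasDerivAt (fun z : ℂ => ∫ θ in (0:ℝ)..Real.pi, 1 / (z - (Real.cos θ : ℂ)))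
      (∫ θ in (0:ℝ)..Real.pi, -1 / (z0 - (Real.cos θ : ℂ)) ^ 2) z0 := by
  obtain ⟨ε, hε, hεU⟩ := Metric.isOpen_iff.1 aux_seg_compact.isClosed.isOpen_compl z0 hz
  have hd : ∀ z ∉ seg, ∀ θ : ℝ, HasDerivAt (fun z : ℂ => 1 / (z - (Real.cos θ : ℂ)))
      (-1 / (z - (Real.cos θ : ℂ)) ^ 2) z := by
    intro z hz θ
    have := ((hasDerivAt_id z).sub_const (Real.cos θ : ℂ)).inv (aux_ne z hz θ)
    refine (this.congr_deriv (by simp)).congr_of_eventuallyEq (Eventually.of_forall fun w => ?_)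
    simp [one_div]
  have hsub : Metric.ball z0 (2 * (ε / 4)) ⊆ segᶜ :=
    (Metric.ball_subset_ball (by linarith)).trans hεU
  have := aux_diffInt (fun z θ => 1 / (z - (Real.cos θ : ℂ))) z0 (ε / 4) (1 / (ε / 2))
    (by positivity) (fun z hz => aux_cont_inv z (hsub hz))
    (fun θ z hz => (hd z (hsub hz) θ).differentiableAt.differentiableWithinAt) ?_
  · convert this using 1
    exact intervalIntegral.integral_congr fun θ _ => ((hd z0 hz θ).deriv).symm
  · intro θ z hz
    rw [norm_div, norm_one]
    apply one_div_le_one_div_of_le (by positivity)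
    have h1 : ε ≤ dist (Real.cos θ : ℂ) z0 := by
      by_contra hlt
      exact hεU (Metric.mem_ball.2 (not_le.1 hlt)) (aux_cos_mem θ)
    rw [Metric.mem_ball] at hz
    rw [← dist_eq_norm]
    linarith [dist_triangle (Real.cos θ : ℂ) z z0, dist_comm z (Real.cos θ : ℂ)]

theorem aux_ode (z : ℂ) (hz : z ∉ seg) :
    (z ^ 2 - 1) * (∫ θ in (0:ℝ)..Real.pi, -1 / (z - (Real.cos θ : ℂ)) ^ 2)
      + z * (∫ θ in (0:ℝ)..Real.pi, 1 / (z - (Real.cos θ : ℂ))) = 0 := by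
  have hne := aux_ne z hz
  have c1 : Continuous fun θ : ℝ => -1 / (z - (Real.cos θ : ℂ)) ^ 2 :=
    Continuous.div continuous_const (by fun_prop) (fun θ => pow_ne_zero 2 (hne θ))
  have c2 := aux_cont_inv z hz
  rw [← intervalIntegral.integral_const_mul, ← intervalIntegral.integral_const_mul,
    ← intervalIntegral.integral_add ((c1.const_mul _).intervalIntegrable _ _)
      ((c2.const_mul _).intervalIntegrable _ _)]
  have hder : ∀ θ : ℝ, HasDerivAt (fun θ : ℝ => -((Real.sin θ : ℂ) / (z - (Real.cos θ : ℂ))))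
      ((z ^ 2 - 1) * (-1 / (z - (Real.cos θ : ℂ)) ^ 2) + z * (1 / (z - (Real.cos θ : ℂ)))) θ := by
    intro θ
    have h1 : HasDerivAt (fun θ : ℝ => (Real.sin θ : ℂ)) (Real.cos θ : ℂ) θ :=
      (Real.hasDerivAt_sin θ).ofReal_comp
    have h2 : HasDerivAt (fun θ : ℝ => (Real.cos θ : ℂ)) ((-Real.sin θ : ℝ) : ℂ) θ :=
      (Real.hasDerivAt_cos θ).ofReal_comp
    have h3 := (h1.div (h2.const_sub z) (hne θ)).neg
    refine h3.congr_deriv ?_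
    have h4 : (Real.sin θ : ℂ) ^ 2 + (Real.cos θ : ℂ) ^ 2 = 1 := by
      exact_mod_cast Real.sin_sq_add_cos_sq θ
    have := hne θ
    push_cast
    push_cast at this h4
    field_simp
    linear_combination h4
  rw [intervalIntegral.integral_eq_sub_of_hasDerivAt (fun θ _ => hder θ)
    (((c1.const_mul _).add (c2.const_mul _)).intervalIntegrable _ _)]
  simp

/-- The Cauchy transform of the arcsine law. -/
theorem aux_main (s : ℂ → ℂ) (hs : AnalyticOn ℂ s segᶜ)
    (hs2 : ∀ z ∈ segᶜ, s z ^ 2 = z ^ 2 - 1)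
    (hsinf : Filter.Tendsto (fun z => s z / z) (Filter.cocompact ℂ) (nhds 1))
    (z : ℂ) (hz : z ∉ seg) :
    s z * (∫ θ in (0:ℝ)..Real.pi, 1 / (z - (Real.cos θ : ℂ))) = Real.pi := by
  have hopen : IsOpen segᶜ := aux_seg_compact.isClosed.isOpen_compl
  set I : ℂ → ℂ := fun z => ∫ θ in (0:ℝ)..Real.pi, 1 / (z - (Real.cos θ : ℂ)) with hI
  have hsne : ∀ w ∉ seg, s w ≠ 0 := by
    intro w hw h0
    have := hs2 w hw
    rw [h0] at this
    have h1 : (w - 1) * (w + 1) = 0 := by linear_combination -this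
    rcases mul_eq_zero.1 h1 with h | h
    · exact hw ⟨1, by simp, by rw [sub_eq_zero.1 h]; simp⟩
    · exact hw ⟨-1, by simp, by rw [eq_neg_of_add_eq_zero_left h]; simp⟩
  have hder : ∀ w ∉ seg, HasDerivAt (fun w => s w * I w) 0 w := by
    intro w hw
    have hsd : HasDerivAt s (deriv s w) w :=
      (hs.differentiableOn.differentiableAt (hopen.mem_nhds hw)).hasDerivAt
    have h1 : HasDerivAt (fun w => s w ^ 2) (2 * w) w := by
      have : HasDerivAt (fun w : ℂ => w ^ 2 - 1) (2 * w) w := by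
        simpa using (hasDerivAt_pow 2 w).sub_const 1
      refine this.congr_of_eventuallyEq ?_
      filter_upwards [hopen.mem_nhds hw] with y hy using hs2 y hy
    have h2 := (hsd.pow 2).unique h1
    refine (hsd.mul (aux_I_deriv w hw)).congr_deriv ?_
    have h3 := aux_ode w hw
    have h4 := hs2 w hw
    have h5 := hsne w hw
    apply mul_left_cancel₀ h5
    norm_num at h2
    rw [← h4] at h3
    linear_combination h3 +
      (1 / 2 * ∫ θ in (0:ℝ)..Real.pi, 1 / (w - (Real.cos θ : ℂ))) * h2
  have hz0 : z ≠ 0 := by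
    rintro rfl
    exact hz ⟨0, by norm_num, by simp⟩
  have hray : ∀ t : ℝ, 1 ≤ t → (t : ℂ) * z ∉ seg := by
    rintro t ht ⟨x, hx, hxe⟩
    have ht0 : 0 < t := by linarith
    refine hz ⟨x / t, ⟨?_, ?_⟩, ?_⟩
    · rw [le_div_iff₀ ht0]; linarith [hx.1]
    · rw [div_le_iff₀ ht0]; linarith [hx.2]
    · have : (t : ℂ) ≠ 0 := by exact_mod_cast ht0.ne'
      push_cast
      rw [hxe]
      field_simp
  have hcst : ∀ t : ℝ, 1 ≤ t → s (t * z) * I (t * z) = s z * I z := by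
    intro T hT
    have hd : ∀ t : ℝ, 1 ≤ t → HasDerivAt (fun t : ℝ => s (t * z) * I (t * z)) 0 t := by
      intro t ht
      have h1 : HasDerivAt (fun t : ℝ => (t : ℂ) * z) z t := by
        simpa using (HasDerivAt.ofReal_comp (hasDerivAt_id t)).mul_const z
      have := HasDerivAt.comp_of_eq (h₂ := fun w => s w * I w) t (hder _ (hray t ht)) h1 rfl
      simpa [Function.comp_def] using this
    have := constant_of_has_deriv_right_zero (a := 1) (b := T)
      (f := fun t : ℝ => s (t * z) * I (t * z))
      (fun t ht => (hd t ht.1).continuousAt.continuousWithinAt)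
      (fun t ht => (hd t ht.1).hasDerivWithinAt) T ⟨hT, le_rfl⟩
    simpa using this
  have htop : Tendsto (fun t : ℝ => (t : ℂ) * z) atTop (cocompact ℂ) := by
    rw [← Metric.cobounded_eq_cocompact, ← tendsto_norm_atTop_iff_cobounded]
    simp only [norm_mul, Complex.norm_real, Real.norm_eq_abs]
    exact tendsto_abs_atTop_atTop.atTop_mul_const (norm_pos_iff.2 hz0)
  have hnorm : Tendsto (fun t : ℝ => ‖(t : ℂ) * z‖) atTop atTop := by
    rw [tendsto_norm_atTop_iff_cobounded, Metric.cobounded_eq_cocompact]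
    exact htop
  have hzI : Tendsto (fun t : ℝ => ((t : ℂ) * z) * I (t * z)) atTop (nhds (Real.pi : ℂ)) := by
    rw [tendsto_iff_norm_sub_tendsto_zero]
    have hb : Tendsto (fun t : ℝ => 1 / (‖(t : ℂ) * z‖ - 1) * |Real.pi - 0|) atTop (nhds 0) := by
      have h1 : Tendsto (fun t : ℝ => ‖(t : ℂ) * z‖ - 1) atTop atTop :=
        tendsto_atTop_add_const_right _ (-1) hnorm
      simpa using (h1.inv_tendsto_atTop).mul_const |Real.pi - 0|
    refine squeeze_zero' (Eventually.of_forall fun _ => norm_nonneg _) ?_ hb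
    filter_upwards [eventually_ge_atTop 1, hnorm.eventually_gt_atTop 1] with t ht hn
    have hw := hray t ht
    set w : ℂ := (t : ℂ) * z
    have hne := aux_ne w hw
    have e : w * I w - Real.pi
        = ∫ θ in (0:ℝ)..Real.pi, (Real.cos θ : ℂ) / (w - (Real.cos θ : ℂ)) := by
      have h1 : (Real.pi : ℂ) = ∫ θ in (0:ℝ)..Real.pi, (1 : ℂ) := by simp
      rw [h1, ← intervalIntegral.integral_const_mul, ← intervalIntegral.integral_sub
        (((aux_cont_inv w hw).const_mul w).intervalIntegrable _ _) intervalIntegrable_const]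
      refine intervalIntegral.integral_congr fun θ _ => ?_
      have := hne θ
      field_simp
      ring
    rw [e]
    refine intervalIntegral.norm_integral_le_of_norm_le_const fun θ _ => ?_
    have hc : ‖(Real.cos θ : ℂ)‖ ≤ 1 := by
      rw [Complex.norm_real]; exact Real.abs_cos_le_one θ
    rw [norm_div]
    apply div_le_div₀ zero_le_one hc (by linarith)
    linarith [norm_sub_norm_le w (Real.cos θ : ℂ)]
  have hlim : Tendsto (fun t : ℝ => s (t * z) * I (t * z)) atTop (nhds (Real.pi : ℂ)) := by
    have := (hsinf.comp htop).mul hzI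
    rw [one_mul] at this
    refine this.congr' ?_
    filter_upwards [eventually_ge_atTop 1] with t ht
    have : (t : ℂ) ≠ 0 := by exact_mod_cast (by linarith : t ≠ 0)
    simp only [Function.comp]
    field_simp
  have hlim2 : Tendsto (fun t : ℝ => s (t * z) * I (t * z)) atTop (nhds (s z * I z)) := by
    refine tendsto_const_nhds.congr' ?_
    filter_upwards [eventually_ge_atTop 1] with t ht using (hcst t ht).symm
  exact tendsto_nhds_unique hlim2 hlim

theorem aux_dslope_comm (L : ℂ → ℂ) (x z : ℂ) : dslope L x z = dslope L z x := by
  by_cases h : z = x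
  · rw [h]
  · rw [dslope_of_ne _ h, dslope_of_ne _ (Ne.symm h), slope_comm]

theorem stmt17
    (α β : ℝ) (hα : -1 < α) (hβ : -1 < β)
    (U : Set ℂ) (hUopen : IsOpen U) (hUseg : seg ⊆ U)
    (h : ℂ → ℂ) (hh : AnalyticOn ℂ h U)
    (hhre : ∀ z ∈ U, 0 < (h z).re)
    (hhreal : ∀ x ∈ Set.Icc (-1:ℝ) 1, (h (x:ℂ)).im = 0)
    (L : ℂ → ℂ) (hLan : AnalyticOn ℂ L U)
    (hLexp : ∀ z ∈ U, Complex.exp (L z) = h z)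
    (hLreal : ∀ x ∈ Set.Icc (-1:ℝ) 1, (L (x:ℂ)).im = 0)
    (s : ℂ → ℂ) (hs : AnalyticOn ℂ s segᶜ)
    (hs2 : ∀ z ∈ segᶜ, s z ^ 2 = z ^ 2 - 1)
    (hsinf : Filter.Tendsto (fun z => s z / z) (Filter.cocompact ℂ) (nhds 1))
    (F : ℂ → ℂ)
    (hF : ∀ z ∈ U \ seg, F z = L z / s z - (1 / (Real.pi : ℂ)) *
      ∫ x in (-1:ℝ)..1, L (x:ℂ) / (((Real.sqrt (1 - x ^ 2) : ℝ) : ℂ) * (z - (x:ℂ)))) :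
    ∃ V : Set ℂ, IsOpen V ∧ seg ⊆ V ∧ V ⊆ U ∧
      ∃ G : ℂ → ℂ, AnalyticOn ℂ G V ∧
        (∀ z ∈ V, z ∉ seg → G z = F z) ∧
        (∃ c₀ : ℂ, Filter.Tendsto F (nhdsWithin 1 (V \ seg)) (nhds c₀)) ∧
        (∃ d₀ : ℂ, Filter.Tendsto F (nhdsWithin (-1) (V \ seg)) (nhds d₀)) ∧
        (∃ pc : FormalMultilinearSeries ℂ ℂ ℂ, HasFPowerSeriesAt G pc 1) ∧
        (∃ pd : FormalMultilinearSeries ℂ ℂ ℂ, HasFPowerSeriesAt G pd (-1)) := by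
  have hLd : DifferentiableOn ℂ L U := hLan.differentiableOn
  set J : ℂ → ℂ := fun z => ∫ θ in (0:ℝ)..Real.pi, dslope L (Real.cos θ : ℂ) z with hJ
  set G : ℂ → ℂ := fun z => (1 / (Real.pi : ℂ)) * J z with hG
  have hcont : ∀ z ∈ U, Continuous fun θ : ℝ => dslope L (Real.cos θ : ℂ) z := by
    intro z hz
    have h1 : ContinuousOn (dslope L z) U :=
      (continuousOn_dslope (hUopen.mem_nhds hz)).2
        ⟨hLd.continuousOn, hLd.differentiableAt (hUopen.mem_nhds hz)⟩
    have h2 : Continuous fun θ : ℝ => dslope L z (Real.cos θ : ℂ) :=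
      h1.comp_continuous (by fun_prop) fun θ => hUseg (aux_cos_mem θ)
    exact h2.congr fun θ => aux_dslope_comm L _ _
  have hGd : DifferentiableOn ℂ G U := by
    intro z0 hz0
    obtain ⟨r, hr, B, hrU, hB⟩ := aux_bound U hUopen hUseg L hLd z0 hz0
    have := aux_diffInt (fun z θ => dslope L (Real.cos θ : ℂ) z) z0 r B hr
      (fun z hz => hcont z (hrU hz))
      (fun θ => ((Complex.differentiableOn_dslope
        (hUopen.mem_nhds (hUseg (aux_cos_mem θ)))).2 hLd).mono hrU)
      (fun θ z hz => hB _ (aux_cos_mem θ) z hz)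
    exact (this.differentiableAt.const_mul (1 / (Real.pi : ℂ))).differentiableWithinAt
  have hGF : ∀ z ∈ U, z ∉ seg → G z = F z := by
    intro z hzU hz
    have hne := aux_ne z hz
    have hmain := aux_main s hs hs2 hsinf z hz
    have hpi : (Real.pi : ℂ) ≠ 0 := by exact_mod_cast Real.pi_ne_zero
    have hsz : s z ≠ 0 := by
      intro h0
      rw [h0, zero_mul] at hmain
      exact hpi hmain.symm
    rw [hF z ⟨hzU, hz⟩]
    have e1 : (∫ x in (-1:ℝ)..1, L (x:ℂ) / (((Real.sqrt (1 - x ^ 2) : ℝ) : ℂ) * (z - (x:ℂ))))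
        = ∫ θ in (0:ℝ)..Real.pi, L (Real.cos θ : ℂ) / (z - (Real.cos θ : ℂ)) := by
      rw [← aux_subst (fun x => L (x : ℂ) / (z - (x : ℂ)))]
      refine intervalIntegral.integral_congr fun x _ => ?_
      rw [div_div, mul_comm]
    have hLc : Continuous fun θ : ℝ => L (Real.cos θ : ℂ) :=
      hLd.continuousOn.comp_continuous (by fun_prop) fun θ => hUseg (aux_cos_mem θ)
    have hLc2 : Continuous fun θ : ℝ => L (Real.cos θ : ℂ) / (z - (Real.cos θ : ℂ)) :=
      hLc.div (by fun_prop) hne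
    have e2 : J z = L z * (∫ θ in (0:ℝ)..Real.pi, 1 / (z - (Real.cos θ : ℂ)))
        - ∫ θ in (0:ℝ)..Real.pi, L (Real.cos θ : ℂ) / (z - (Real.cos θ : ℂ)) := by
      rw [← intervalIntegral.integral_const_mul, ← intervalIntegral.integral_sub
        (((aux_cont_inv z hz).const_mul _).intervalIntegrable _ _) (hLc2.intervalIntegrable _ _)]
      refine intervalIntegral.integral_congr fun θ _ => ?_
      rw [dslope_of_ne _ (sub_ne_zero.1 (hne θ)), slope_def_field]
      ring
    rw [e1]
    simp only [hG]
    rw [e2, ← hmain]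
    have hIne : (∫ θ in (0:ℝ)..Real.pi, 1 / (z - (Real.cos θ : ℂ))) ≠ 0 := by
      intro h0
      rw [h0, mul_zero] at hmain
      exact hpi hmain.symm
    field_simp
  have hGa : AnalyticOnNhd ℂ G U := hGd.analyticOnNhd hUopen
  have m1 : (1 : ℂ) ∈ U := hUseg ⟨1, by simp, by simp⟩
  have m2 : (-1 : ℂ) ∈ U := hUseg ⟨-1, by simp, by simp⟩
  have hlim : ∀ a ∈ U, Tendsto F (nhdsWithin a (U \ seg)) (nhds (G a)) := by
    intro a ha
    have h1 : Tendsto G (nhdsWithin a (U \ seg)) (nhds (G a)) :=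
      (hGa a ha).continuousAt.tendsto.mono_left nhdsWithin_le_nhds
    refine h1.congr' ?_
    filter_upwards [self_mem_nhdsWithin] with z hz using hGF z hz.1 hz.2
  exact ⟨U, hUopen, hUseg, Subset.rfl, G, hGa.analyticOn, hGF, ⟨_, hlim 1 m1⟩, ⟨_, hlim (-1) m2⟩,
    hGa 1 m1, hGa (-1) m2⟩
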